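/- arXiv:2307.01303 — 2 statements merged into one kernel-verified Lean document; each statement's English description precedes it below -/
import Mathlib

section
/- Let p be a prime and let K be an algebraically closed field with a nonarchimedean multiplicative norm under which it is a complete normed field, equipped with an isometric ℚ_p-algebra structure. Then the p-adic logarithm is surjective onto K: for every a ∈ K there exists u ∈ K with ‖u − 1‖ < 1 and log(u) = ∑_{n≥1} (−1)^{n+1}(u−1)^n/n = a. -/
/-- The `p`-adic logarithm series `log(u) = ∑_{n ≥ 1} (-1)^{n+1} (u - 1)^n / n`
(here reindexed over `n : ℕ` with term `(-1)^n (u-1)^{n+1} / (n+1)`). -/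
noncomputable def pLog {K : Type*} [NormedField K] (u : K) : K :=
  ∑' n : ℕ, ((-1 : K) ^ n / ((n : K) + 1)) * (u - 1) ^ (n + 1)

open Filter Topology in
lemma pLog_local_surj {K : Type*} [NontriviallyNormedField K] [CompleteSpace K]
    (hb : ∀ n : ℕ, ‖((n : K) + 1)⁻¹‖ ≤ n + 1) :
    ∀ᶠ a in 𝓝 (0 : K), ∃ u : K, ‖u - 1‖ < 1 ∧ pLog u = a := by
  set c : ℕ → K := fun n => (-1) ^ (n + 1) / (n : K) with hc
  set P := FormalMultilinearSeries.ofScalars K c with hP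
  have hcb : ∀ n, ‖c n‖ ≤ n := by
    intro n
    rcases n with _ | n
    · simp [hc]
    · have := hb n
      simpa [hc] using this
  have hrad : 0 < P.radius := by
    refine lt_of_lt_of_le ?_ (P.le_radius_of_bound 1 (r := 1/2) ?_)
    · simp
    · intro n
      rw [hP, FormalMultilinearSeries.ofScalars_norm]
      have h2 : (n : ℝ) ≤ 2 ^ n := by exact_mod_cast Nat.lt_two_pow_self.le
      calc ‖c n‖ * (((1/2 : NNReal) : ℝ)) ^ n ≤ 2 ^ n * (1/2) ^ n := by
            push_cast
            gcongr
            exact (hcb n).trans h2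
        _ = 1 := by rw [← mul_pow]; norm_num
  have hfp := (P.hasFPowerSeriesOnBall hrad).hasFPowerSeriesAt.hasStrictDerivAt
  have h1 : (P 1 fun _ => (1 : K)) = 1 := by
    have h2 : P.coeff 1 = c 1 := FormalMultilinearSeries.coeff_ofScalars (p := c) (n := 1)
    have h3 : c 1 = 1 := by simp [hc]
    exact h2.trans h3
  rw [h1] at hfp
  have hmap := hfp.map_nhds_eq one_ne_zero
  have hsum : ∀ x : K, ‖x‖ < 1 → P.sum x = pLog (1 + x) := by
    intro x hx
    have e : P.sum x = ∑' n, c n • x ^ n := FormalMultilinearSeries.ofScalars_sum_eq c x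
    have hs : Summable fun n => c n • x ^ n := by
      refine Summable.of_norm_bounded (g := fun n : ℕ => (n : ℝ) ^ 1 * ‖x‖ ^ n)
        (summable_pow_mul_geometric_of_norm_lt_one 1 (by simpa using hx)) ?_
      intro n
      rw [norm_smul, norm_pow, pow_one]
      gcongr
      exact hcb n
    rw [e, hs.tsum_eq_zero_add, pLog]
    simp only [hc, add_sub_cancel_left, smul_eq_mul]
    simp [pow_succ]
  have h0 : P.sum 0 = 0 := by
    rw [hsum 0 (by simp), pLog]; simp
  rw [h0] at hmap
  rw [← hmap, eventually_map]
  filter_upwards [Metric.ball_mem_nhds (0 : K) one_pos] with x hx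
  have hx : ‖x‖ < 1 := by simpa using hx
  exact ⟨1 + x, by simpa using hx, (hsum x hx).symm⟩

section
variable {p : ℕ} [hp : Fact p.Prime] {K : Type*} [NormedField K] [Algebra ℚ_[p] K]

lemma norm_nat_eq (hiso : ∀ a : ℚ_[p], ‖algebraMap ℚ_[p] K a‖ = ‖a‖) (n : ℕ) :
    ‖(n : K)‖ = ‖(n : ℚ_[p])‖ := by
  rw [← hiso, map_natCast]

lemma norm_nat_le_one (hiso : ∀ a : ℚ_[p], ‖algebraMap ℚ_[p] K a‖ = ‖a‖) (n : ℕ) :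
    ‖(n : K)‖ ≤ 1 := by
  rw [norm_nat_eq hiso]
  exact_mod_cast Padic.norm_int_le_one (p := p) n

lemma norm_p_K (hiso : ∀ a : ℚ_[p], ‖algebraMap ℚ_[p] K a‖ = ‖a‖) :
    ‖(p : K)‖ = (p : ℝ)⁻¹ := by
  rw [norm_nat_eq hiso, Padic.norm_p]

lemma norm_p_lt (hiso : ∀ a : ℚ_[p], ‖algebraMap ℚ_[p] K a‖ = ‖a‖) :
    ‖(p : K)‖ < 1 := by
  rw [norm_p_K hiso]
  exact inv_lt_one_of_one_lt₀ (by exact_mod_cast hp.out.one_lt)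

lemma norm_inv_succ_le (hiso : ∀ a : ℚ_[p], ‖algebraMap ℚ_[p] K a‖ = ‖a‖) (n : ℕ) :
    ‖((n : K) + 1)⁻¹‖ ≤ n + 1 := by
  have h := norm_nat_eq (K := K) hiso (n + 1)
  have h0 : ((n + 1 : ℕ) : ℚ_[p]) ≠ 0 := by exact_mod_cast n.succ_ne_zero
  rw [Padic.norm_eq_zpow_neg_valuation h0, Padic.valuation_natCast] at h
  rw [← Nat.cast_succ, norm_inv, h, zpow_neg, inv_inv, zpow_natCast]
  exact_mod_cast Nat.le_of_dvd n.succ_pos pow_padicValNat_dvd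

lemma ne_zero_succ (hiso : ∀ a : ℚ_[p], ‖algebraMap ℚ_[p] K a‖ = ‖a‖) (n : ℕ) :
    (n : K) + 1 ≠ 0 := by
  have h := norm_nat_eq (K := K) hiso (n + 1)
  have h0 : ((n + 1 : ℕ) : ℚ_[p]) ≠ 0 := by exact_mod_cast n.succ_ne_zero
  push_cast at h h0
  rw [← norm_ne_zero_iff, h]
  simpa using h0

lemma p_ne_zero_K (hiso : ∀ a : ℚ_[p], ‖algebraMap ℚ_[p] K a‖ = ‖a‖) : (p : K) ≠ 0 := by
  rw [← norm_ne_zero_iff, norm_p_K hiso]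
  simpa using hp.out.ne_zero

/-- `C(p^n, j+1) = p^n C(p^n - 1, j) / (j+1)` in `K`. -/
lemma choose_pow_eq (hiso : ∀ a : ℚ_[p], ‖algebraMap ℚ_[p] K a‖ = ‖a‖) (n j : ℕ) :
    (((p ^ n).choose (j + 1) : ℕ) : K) = (p : K) ^ n * (((p ^ n - 1).choose j : ℕ) : K) / (j + 1) := by
  have h := Nat.add_one_mul_choose_eq (p ^ n - 1) j
  rw [Nat.sub_add_cancel (Nat.one_le_pow _ _ hp.out.pos)] at h
  rw [eq_div_iff (ne_zero_succ hiso j)]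
  have hcast := congrArg (Nat.cast : ℕ → K) h.symm
  push_cast at hcast
  exact hcast

open Filter Topology in
lemma tendsto_p_pow (hiso : ∀ a : ℚ_[p], ‖algebraMap ℚ_[p] K a‖ = ‖a‖) :
    Tendsto (fun n : ℕ => (p : K) ^ n) atTop (𝓝 0) :=
  tendsto_pow_atTop_nhds_zero_of_norm_lt_one (norm_p_lt hiso)

open Filter Topology in
lemma tendsto_choose (hiso : ∀ a : ℚ_[p], ‖algebraMap ℚ_[p] K a‖ = ‖a‖) (j : ℕ) :
    Tendsto (fun n : ℕ => (((p ^ n - 1).choose j : ℕ) : K)) atTop (𝓝 ((-1) ^ j)) := by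
  induction j with
  | zero => simp
  | succ j ih =>
    have h1 : Tendsto (fun n : ℕ => (((p ^ n).choose (j + 1) : ℕ) : K)) atTop (𝓝 0) := by
      simp only [choose_pow_eq hiso]
      simpa using ((tendsto_p_pow hiso).mul ih).div_const ((j : K) + 1)
    have h2 := h1.sub ih
    rw [zero_sub, ← neg_one_mul, ← pow_succ'] at h2
    refine h2.congr fun n => ?_
    have h := Nat.choose_succ_succ (p ^ n - 1) j
    rw [Nat.succ_eq_add_one, Nat.sub_add_cancel (Nat.one_le_pow _ _ hp.out.pos)] at h
    rw [h]; push_cast; ring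

open Filter Topology in
/-- `log u = lim (u^{p^n} - 1)/p^n`. -/
lemma tendsto_pLog [CompleteSpace K] (hiso : ∀ a : ℚ_[p], ‖algebraMap ℚ_[p] K a‖ = ‖a‖)
    (u : K) (hu : ‖u - 1‖ < 1) :
    Tendsto (fun n : ℕ => (u ^ (p ^ n) - 1) / (p : K) ^ n) atTop (𝓝 (pLog u)) := by
  have key := tendsto_tsum_of_dominated_convergence (𝓕 := atTop)
    (f := fun n j : ℕ => ((((p ^ n - 1).choose j : ℕ) : K) / ((j : K) + 1)) * (u - 1) ^ (j + 1))
    (g := fun j : ℕ => ((-1 : K) ^ j / ((j : K) + 1)) * (u - 1) ^ (j + 1))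
    (bound := fun j : ℕ => ((j : ℝ) + 1) * ‖u - 1‖ ^ (j + 1)) ?_ ?_ ?_
  · refine key.congr fun n => ?_
    have hpn : (p : K) ^ n ≠ 0 := pow_ne_zero _ (p_ne_zero_K hiso)
    rw [tsum_eq_sum (s := Finset.range (p ^ n)), eq_div_iff hpn, Finset.sum_mul]
    · have h := add_pow (u - 1) 1 (p ^ n)
      rw [sub_add_cancel, Finset.sum_range_succ'] at h
      rw [h]
      simp only [one_pow, mul_one, pow_zero, Nat.choose_zero_right, Nat.cast_one,
        add_sub_cancel_right]
      refine Finset.sum_congr rfl fun j _ => ?_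
      rw [choose_pow_eq hiso]; ring
    · intro j hj
      have : p ^ n - 1 < j := by
        have := Nat.one_le_pow n p hp.out.pos
        simp at hj; omega
      simp [Nat.choose_eq_zero_of_lt this]
  · have := summable_pow_mul_geometric_of_norm_lt_one (R := ℝ) 1 (r := ‖u - 1‖) (by simpa using hu)
    simpa using (summable_nat_add_iff 1).2 this
  · intro j
    exact ((tendsto_choose hiso j).div_const _).mul_const _
  · refine Eventually.of_forall fun n j => ?_
    rw [norm_mul, norm_pow, div_eq_mul_inv, norm_mul]
    gcongr
    calc _ ≤ 1 * ((j : ℝ) + 1) := by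
          gcongr
          · exact norm_nat_le_one hiso _
          · exact norm_inv_succ_le hiso j
      _ = _ := one_mul _

lemma root_near_one (hna : ∀ x y : K, ‖x + y‖ ≤ max ‖x‖ ‖y‖)
    (hiso : ∀ a : ℚ_[p], ‖algebraMap ℚ_[p] K a‖ = ‖a‖) (w : K) (hw : ‖w ^ p - 1‖ < 1) :
    ‖w - 1‖ < 1 := by
  have := IsUltrametricDist.isUltrametricDist_of_forall_norm_add_le_max_norm hna
  have hwp : ‖w‖ ≤ 1 := by
    have h : ‖w ^ p‖ ≤ 1 := by
      have := hna (w ^ p - 1) 1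
      rw [sub_add_cancel, norm_one] at this
      exact this.trans (max_le hw.le le_rfl)
    rw [norm_pow] at h
    exact (pow_le_one_iff_of_nonneg (norm_nonneg _) hp.out.ne_zero).1 h
  have hx : ‖w - 1‖ ≤ 1 := by
    have := hna w (-1)
    rw [← sub_eq_add_neg, norm_neg, norm_one] at this
    exact this.trans (max_le hwp le_rfl)
  have h := add_pow_prime_eq hp.out (w - 1) 1
  rw [sub_add_cancel] at h
  simp only [one_pow, mul_one] at h
  set S := ∑ k ∈ Finset.Ioo 0 p, (w - 1) ^ (k - 1) * ((p.choose k / p : ℕ) : K) with hS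
  have hSn : ‖S‖ ≤ 1 := by
    refine IsUltrametricDist.norm_sum_le_of_forall_le_of_nonneg zero_le_one fun k _ => ?_
    rw [norm_mul, norm_pow]
    exact mul_le_one₀ (pow_le_one₀ (norm_nonneg _) hx) (norm_nonneg _) (norm_nat_le_one hiso _)
  have h3 : ‖(p : K) * (w - 1) * S‖ < 1 := by
    rw [norm_mul, norm_mul, mul_assoc]
    refine lt_of_le_of_lt ?_ (norm_p_lt hiso)
    exact mul_le_of_le_one_right (norm_nonneg _) (mul_le_one₀ hx (norm_nonneg _) hSn)
  have h4 : (w - 1) ^ p = (w ^ p - 1) + -((p : K) * (w - 1) * S) := by rw [h]; ring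
  have h5 : ‖w - 1‖ ^ p < 1 := by
    rw [← norm_pow, h4]
    refine (hna _ _).trans_lt (max_lt hw ?_)
    rwa [norm_neg]
  exact (pow_lt_one_iff_of_nonneg (norm_nonneg _) hp.out.ne_zero).1 h5

lemma root_near_one_pow (hna : ∀ x y : K, ‖x + y‖ ≤ max ‖x‖ ‖y‖)
    (hiso : ∀ a : ℚ_[p], ‖algebraMap ℚ_[p] K a‖ = ‖a‖) (k : ℕ) (w : K)
    (hw : ‖w ^ (p ^ k) - 1‖ < 1) : ‖w - 1‖ < 1 := by
  induction k with
  | zero => simpa using hw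
  | succ k ih =>
    rw [pow_succ, pow_mul] at hw
    exact ih (root_near_one hna hiso _ hw)

open Filter Topology in
lemma pLog_pow [CompleteSpace K]
    (hiso : ∀ a : ℚ_[p], ‖algebraMap ℚ_[p] K a‖ = ‖a‖) (k : ℕ) (u : K)
    (hu : ‖u - 1‖ < 1) (hv : ‖u ^ (p ^ k) - 1‖ < 1) :
    pLog (u ^ (p ^ k)) = (p : K) ^ k * pLog u := by
  have h1 := tendsto_pLog hiso _ hv
  have h2 := ((tendsto_add_atTop_iff_nat k).2 (tendsto_pLog hiso _ hu)).const_mul ((p : K) ^ k)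
  refine tendsto_nhds_unique h1 (h2.congr fun n => ?_)
  have hp0 := p_ne_zero_K (K := K) hiso
  rw [← pow_mul, ← pow_add, add_comm k n, pow_add (p : K) n k]
  field_simp

end

/-- Let `K` be an algebraically closed complete nonarchimedean normed
field with an isometric `ℚ_p`-algebra structure. Then the `p`-adic logarithm is surjective
onto `K`: every `a ∈ K` is `log(u)` for some `u` with `‖u - 1‖ < 1`. -/
theorem stmt8 (p : ℕ) [Fact p.Prime] (K : Type*) [NormedField K] [CompleteSpace K]
    [IsAlgClosed K] [Algebra ℚ_[p] K]
    (hna : ∀ x y : K, ‖x + y‖ ≤ max ‖x‖ ‖y‖)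
    (hiso : ∀ a : ℚ_[p], ‖algebraMap ℚ_[p] K a‖ = ‖a‖) :
    ∀ a : K, ∃ u : K, ‖u - 1‖ < 1 ∧ pLog u = a := by
  intro a
  have hp : p.Prime := Fact.out
  have hloc : ∀ᶠ a in nhds (0 : K), ∃ u : K, ‖u - 1‖ < 1 ∧ pLog u = a := by
    let _ : NontriviallyNormedField K :=
      { ‹NormedField K› with
        non_trivial := ⟨(p : K)⁻¹, by
          rw [norm_inv]
          exact (one_lt_inv₀ (norm_pos_iff.2 (p_ne_zero_K hiso))).2 (norm_p_lt hiso)⟩ }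
    exact pLog_local_surj (K := K) (norm_inv_succ_le hiso)
  have ht : Filter.Tendsto (fun n : ℕ => (p : K) ^ n * a) Filter.atTop (nhds 0) := by
    simpa using (tendsto_p_pow hiso).mul_const a
  obtain ⟨k, v, hv, hva⟩ := (ht.eventually hloc).exists
  obtain ⟨u, rfl⟩ := IsAlgClosed.exists_pow_nat_eq v (n := p ^ k) (pow_pos hp.pos k)
  have hu := root_near_one_pow hna hiso k u hv
  refine ⟨u, hu, ?_⟩
  rw [pLog_pow hiso k u hu hv] at hva
  exact mul_left_cancel₀ (pow_ne_zero _ (p_ne_zero_K hiso)) hva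
end

section
/- Let p be a prime and let K be an algebraically closed field with a nonarchimedean multiplicative norm under which it is a complete normed field, equipped with an isometric ℚ_p-algebra structure, and set α = 1/(p−1) if p is odd and α = 2 if p = 2. Then an exponential for K exists: there is a group homomorphism Exp : (K, +) → ({u ∈ K : ‖u − 1‖ < 1}, ×) such that log(Exp(a)) = a for all a ∈ K, and such that Exp(x) = exp(x) = ∑_{n≥0} x^n/n! whenever ‖x‖ < p^{−α}. -/
/-- `α = 1/(p-1)` for odd `p`, and `α = 2` for `p = 2`. -/
noncomputable def padicAlpha (p : ℕ) : ℝ := if p = 2 then 2 else 1 / ((p : ℝ) - 1)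

/-- The `p`-adic exponential series `exp(x) = ∑_{n ≥ 0} x^n / n!`. -/
noncomputable def pExp {K : Type*} [NormedField K] (x : K) : K :=
  ∑' n : ℕ, (n.factorial : K)⁻¹ * x ^ n

open Filter Topology

namespace PExpAux

variable {K : Type*} [NormedField K]

/-- Radius constant bounds inverse factorials. -/
lemma fact_bound (p : ℕ) [hp : Fact p.Prime]
    (hn : ∀ n : ℕ, n ≠ 0 → ‖(n : K)‖ = ((p : ℝ) ^ (padicValNat p n))⁻¹) (n : ℕ) :
    ‖((n.factorial : ℕ) : K)⁻¹‖ ≤ ((p : ℝ) ^ (1 / ((p : ℝ) - 1))) ^ n := by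
  have hp1 : (1 : ℝ) < p := by exact_mod_cast hp.out.one_lt
  rw [norm_inv, hn _ n.factorial_ne_zero, inv_inv, ← Real.rpow_natCast, ← Real.rpow_natCast,
    ← Real.rpow_mul (by positivity)]
  apply Real.rpow_le_rpow_of_exponent_le hp1.le
  have h := sub_one_mul_padicValNat_factorial (p := p) n
  have h2 : (p - 1) * padicValNat p n.factorial ≤ n := by omega
  have h3 : ((p : ℝ) - 1) * padicValNat p n.factorial ≤ n := by
    have : (((p - 1 : ℕ) : ℝ)) = (p : ℝ) - 1 := by
      rw [Nat.cast_sub hp.out.one_lt.le]; simp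
    rw [← this]; exact_mod_cast h2
  rw [one_div, inv_mul_eq_div, le_div_iff₀ (by linarith)]
  linarith

lemma inv_bound (p : ℕ) [hp : Fact p.Prime]
    (hn : ∀ n : ℕ, n ≠ 0 → ‖(n : K)‖ = ((p : ℝ) ^ (padicValNat p n))⁻¹) (n : ℕ) :
    ‖((n : K) + 1)⁻¹‖ ≤ (n : ℝ) + 1 := by
  have h := hn (n + 1) (by omega)
  push_cast at h
  rw [norm_inv, h, inv_inv]
  exact_mod_cast Nat.le_of_dvd (by omega) (pow_padicValNat_dvd (p := p) (n := n + 1))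

lemma nat_le (p : ℕ) [hp : Fact p.Prime]
    (hn : ∀ n : ℕ, n ≠ 0 → ‖(n : K)‖ = ((p : ℝ) ^ (padicValNat p n))⁻¹) (n : ℕ) :
    ‖(n : K)‖ ≤ 1 := by
  rcases eq_or_ne n 0 with rfl | h
  · simp
  · rw [hn n h]
    have hp1 : (1 : ℝ) ≤ p := by exact_mod_cast hp.out.one_lt.le
    exact inv_le_one_of_one_le₀ (one_le_pow₀ hp1)

lemma p_norm (p : ℕ) [hp : Fact p.Prime]
    (hn : ∀ n : ℕ, n ≠ 0 → ‖(n : K)‖ = ((p : ℝ) ^ (padicValNat p n))⁻¹) :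
    ‖(p : K)‖ < 1 := by
  have hp1 : (1 : ℝ) < p := by exact_mod_cast hp.out.one_lt
  rw [hn p hp.out.ne_zero]
  simp only [padicValNat_self, pow_one]
  exact inv_lt_one_of_one_lt₀ hp1

lemma pow_tendsto (p : ℕ) [hp : Fact p.Prime]
    (hn : ∀ n : ℕ, n ≠ 0 → ‖(n : K)‖ = ((p : ℝ) ^ (padicValNat p n))⁻¹) :
    Tendsto (fun n : ℕ => (p : K) ^ n) atTop (𝓝 0) :=
  tendsto_pow_atTop_nhds_zero_of_norm_lt_one (p_norm p hn)

lemma char_zero (p : ℕ) [hp : Fact p.Prime]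
    (hn : ∀ n : ℕ, n ≠ 0 → ‖(n : K)‖ = ((p : ℝ) ^ (padicValNat p n))⁻¹) : CharZero K := by
  refine charZero_of_inj_zero fun n h => ?_
  by_contra h0
  have h1 := hn n h0
  have hp1 : (0 : ℝ) < p := by exact_mod_cast hp.out.pos
  rw [h, norm_zero] at h1
  have : (0 : ℝ) < ((p : ℝ) ^ (padicValNat p n))⁻¹ := by positivity
  linarith

lemma choose_eq [CharZero K] (m k : ℕ) (hm : m ≠ 0) :
    ((m.choose (k + 1) : ℕ) : K) = m * (((m - 1).choose k : ℕ) : K) * ((k : K) + 1)⁻¹ := by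
  obtain ⟨m, rfl⟩ := Nat.exists_eq_succ_of_ne_zero hm
  have h := Nat.add_one_mul_choose_eq m k
  have hk : ((k : K) + 1) ≠ 0 := by exact_mod_cast Nat.succ_ne_zero k
  rw [eq_mul_inv_iff_mul_eq₀ hk]
  simp only [Nat.succ_eq_add_one, Nat.add_sub_cancel] at *
  exact_mod_cast h.symm

lemma choose_tendsto (p : ℕ) [hp : Fact p.Prime]
    (hn : ∀ n : ℕ, n ≠ 0 → ‖(n : K)‖ = ((p : ℝ) ^ (padicValNat p n))⁻¹) (k : ℕ) :
    Tendsto (fun n : ℕ => (((p ^ n - 1).choose k : ℕ) : K)) atTop (𝓝 ((-1) ^ k)) := by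
  have := char_zero p hn
  induction k with
  | zero => simp
  | succ k ih =>
    have h1 : ∀ n : ℕ, (((p ^ n - 1).choose (k + 1) : ℕ) : K) =
        (p : K) ^ n * (((p ^ n - 1).choose k : ℕ) : K) * ((k : K) + 1)⁻¹
          - (((p ^ n - 1).choose k : ℕ) : K) := by
      intro n
      have h0 : p ^ n ≠ 0 := pow_ne_zero _ hp.out.ne_zero
      have h2 := choose_eq (K := K) (p ^ n) k h0
      push_cast at h2
      rw [← h2]
      have h3 : (p ^ n).choose (k + 1) = (p ^ n - 1).choose k + (p ^ n - 1).choose (k + 1) := by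
        obtain ⟨m, hm⟩ := Nat.exists_eq_succ_of_ne_zero h0
        rw [hm]
        exact Nat.choose_succ_succ m k
      rw [h3]; push_cast; ring
    have h4 := (((pow_tendsto p hn).mul ih).mul_const (((k : K) + 1)⁻¹)).sub ih
    refine (h4.congr fun n => (h1 n).symm).trans_eq ?_
    congr 1
    ring

lemma log_limit [CompleteSpace K] (p : ℕ) [hp : Fact p.Prime]
    (hn : ∀ n : ℕ, n ≠ 0 → ‖(n : K)‖ = ((p : ℝ) ^ (padicValNat p n))⁻¹) (u : K)
    (hu : ‖u - 1‖ < 1) :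
    Tendsto (fun n : ℕ => (u ^ (p ^ n) - 1) / (p : K) ^ n) atTop (𝓝 (pLog u)) := by
  have := char_zero p hn
  have hpK : (p : K) ≠ 0 := by exact_mod_cast hp.out.ne_zero
  have key : ∀ n : ℕ, (u ^ (p ^ n) - 1) / (p : K) ^ n =
      ∑' k : ℕ, ((((p ^ n - 1).choose k : ℕ) : K) * ((k : K) + 1)⁻¹) * (u - 1) ^ (k + 1) := by
    intro n
    have h0 : p ^ n ≠ 0 := pow_ne_zero _ hp.out.ne_zero
    rw [tsum_eq_sum (s := Finset.range (p ^ n))]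
    · have h1 : u ^ (p ^ n) = ((u - 1) + 1) ^ (p ^ n) := by ring
      rw [h1, add_pow, Finset.sum_range_succ']
      simp only [one_pow, mul_one, pow_zero, Nat.choose_zero_right, Nat.cast_one,
        add_sub_cancel_right]
      rw [Finset.sum_div]
      refine Finset.sum_congr rfl fun k _ => ?_
      rw [choose_eq _ _ h0]
      push_cast
      field_simp
    · intro k hk
      rw [Nat.choose_eq_zero_of_lt]
      · simp
      · simp at hk; omega
  simp_rw [key]
  unfold pLog
  refine tendsto_tsum_of_dominated_convergence
    (bound := fun k : ℕ => ((k : ℝ) + 1) * ‖u - 1‖ ^ (k + 1)) ?_ ?_ ?_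
  · have := summable_pow_mul_geometric_of_norm_lt_one (R := ℝ) 1 (r := ‖u - 1‖) (by simpa using hu)
    have h2 := (summable_nat_add_iff 1).2 this
    simpa using h2
  · intro k
    simp only [div_eq_mul_inv]
    exact ((choose_tendsto p hn k).mul_const _).mul_const _
  · refine Eventually.of_forall fun n k => ?_
    rw [norm_mul, norm_mul, norm_pow]
    gcongr
    calc _ ≤ 1 * ((k : ℝ) + 1) := by
          gcongr
          · exact nat_le p hn _
          · exact inv_bound p hn k
      _ = _ := one_mul _

lemma log_pow [CompleteSpace K] (p : ℕ) [hp : Fact p.Prime]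
    (hn : ∀ n : ℕ, n ≠ 0 → ‖(n : K)‖ = ((p : ℝ) ^ (padicValNat p n))⁻¹) (u : K) (m : ℕ)
    (hu : ‖u - 1‖ < 1) (hum : ‖u ^ (p ^ m) - 1‖ < 1) :
    pLog (u ^ (p ^ m)) = (p : K) ^ m * pLog u := by
  have := char_zero p hn
  have hpK : (p : K) ≠ 0 := by exact_mod_cast hp.out.ne_zero
  refine tendsto_nhds_unique (log_limit p hn _ hum) ?_
  have h1 := (log_limit p hn _ hu).comp (tendsto_add_atTop_nat m)
  refine (h1.const_mul ((p : K) ^ m)).congr fun n => ?_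
  simp only [Function.comp]
  rw [← pow_mul, ← pow_add, add_comm m n, pow_add (p : K)]
  field_simp

section expo

lemma term_bound (c : ℝ)
    (hc : ∀ n : ℕ, ‖((n.factorial : ℕ) : K)⁻¹‖ ≤ c ^ n) (x : K) (n : ℕ) :
    ‖((n.factorial : ℕ) : K)⁻¹ * x ^ n‖ ≤ (‖x‖ * c) ^ n := by
  rw [norm_mul, norm_pow, mul_pow, mul_comm]
  gcongr
  exact hc n

lemma exp_summable (c : ℝ) (hc0 : 0 ≤ c)
    (hc : ∀ n : ℕ, ‖((n.factorial : ℕ) : K)⁻¹‖ ≤ c ^ n)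
    (x : K) (hx : ‖x‖ * c < 1) :
    Summable fun n : ℕ => ‖((n.factorial : ℕ) : K)⁻¹ * x ^ n‖ :=
  Summable.of_nonneg_of_le (fun _ => norm_nonneg _) (term_bound c hc x)
    (summable_geometric_of_lt_one (by positivity) hx)

lemma exp_add' [CompleteSpace K] [CharZero K] (c : ℝ) (hc0 : 0 ≤ c)
    (hc : ∀ n : ℕ, ‖((n.factorial : ℕ) : K)⁻¹‖ ≤ c ^ n)
    (x y : K) (hx : ‖x‖ * c < 1) (hy : ‖y‖ * c < 1) :
    pExp (x + y) = pExp x * pExp y := by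
  unfold pExp
  rw [tsum_mul_tsum_eq_tsum_sum_antidiagonal_of_summable_norm (exp_summable c hc0 hc x hx)
    (exp_summable c hc0 hc y hy)]
  congr 1
  ext n
  rw [(Commute.all x y).add_pow', Finset.mul_sum]
  refine Finset.sum_congr rfl fun kl hkl => ?_
  rw [Finset.HasAntidiagonal.mem_antidiagonal] at hkl
  have h := Nat.add_choose_mul_factorial_mul_factorial kl.1 kl.2
  rw [hkl, Nat.choose_symm_of_eq_add (show n = kl.2 + kl.1 by omega)] at h
  have h' : ((n.choose kl.1 : ℕ) : K) * (kl.1.factorial : K) * (kl.2.factorial : K)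
      = (n.factorial : K) := by exact_mod_cast h
  have a1 : (kl.1.factorial : K) ≠ 0 := by exact_mod_cast kl.1.factorial_ne_zero
  have a2 : (kl.2.factorial : K) ≠ 0 := by exact_mod_cast kl.2.factorial_ne_zero
  have a3 : (n.factorial : K) ≠ 0 := by exact_mod_cast n.factorial_ne_zero
  rw [nsmul_eq_mul]
  field_simp
  rw [← h']
  ring

lemma exp_eq [CompleteSpace K] (c : ℝ) (hc0 : 0 ≤ c)
    (hc : ∀ n : ℕ, ‖((n.factorial : ℕ) : K)⁻¹‖ ≤ c ^ n)
    (x : K) (hx : ‖x‖ * c < 1) :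
    pExp x - 1 = ∑' n : ℕ, (((n + 1).factorial : ℕ) : K)⁻¹ * x ^ (n + 1) := by
  unfold pExp
  rw [(exp_summable c hc0 hc x hx).of_norm.tsum_eq_zero_add]
  simp

lemma exp_norm [CompleteSpace K] (c : ℝ) (hc0 : 0 ≤ c)
    (hc : ∀ n : ℕ, ‖((n.factorial : ℕ) : K)⁻¹‖ ≤ c ^ n)
    (hna : ∀ x y : K, ‖x + y‖ ≤ max ‖x‖ ‖y‖)
    (x : K) (hx : ‖x‖ * c < 1) : ‖pExp x - 1‖ < 1 := by
  refine lt_of_le_of_lt ?_ hx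
  rw [exp_eq c hc0 hc x hx]
  have hs := (summable_nat_add_iff 1).2 (exp_summable c hc0 hc x hx).of_norm
  refine le_of_tendsto hs.hasSum.tendsto_sum_nat.norm (Eventually.of_forall fun m => ?_)
  have hr : 0 ≤ ‖x‖ * c := by positivity
  induction m with
  | zero => simpa using hr
  | succ m ih =>
    rw [Finset.sum_range_succ]
    refine (hna _ _).trans (max_le ih ?_)
    refine (term_bound c hc x (m + 1)).trans ?_
    exact pow_le_of_le_one hr hx.le (Nat.succ_ne_zero m)

lemma exp_lim [CompleteSpace K] (c : ℝ) (hc0 : 0 ≤ c)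
    (hc : ∀ n : ℕ, ‖((n.factorial : ℕ) : K)⁻¹‖ ≤ c ^ n)
    (x : K) (hx : ‖x‖ * c < 1) (q : K) (hq0 : q ≠ 0) (hq : ‖q‖ < 1) :
    Tendsto (fun n : ℕ => (pExp (q ^ n * x) - 1) / q ^ n) atTop (𝓝 x) := by
  have hb : ∀ n : ℕ, ‖q ^ n * x‖ * c < 1 := by
    intro n
    refine lt_of_le_of_lt ?_ hx
    gcongr
    rw [norm_mul, norm_pow]
    exact mul_le_of_le_one_left (norm_nonneg _) (pow_le_one₀ (norm_nonneg _) hq.le)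
  have key : ∀ n : ℕ, (pExp (q ^ n * x) - 1) / q ^ n =
      ∑' k : ℕ, ((((k + 1).factorial : ℕ) : K)⁻¹ * x ^ (k + 1)) * (q ^ n) ^ k := by
    intro n
    rw [exp_eq c hc0 hc _ (hb n), ← tsum_div_const]
    congr 1
    ext k
    field_simp
    ring
  simp_rw [key]
  have hlim : x = ∑' k : ℕ, ((((k + 1).factorial : ℕ) : K)⁻¹ * x ^ (k + 1)) * (0 : K) ^ k := by
    rw [tsum_eq_single 0]
    · simp
    · intro b hb; simp [hb]
  conv_rhs => rw [hlim]
  refine tendsto_tsum_of_dominated_convergence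
    ((summable_nat_add_iff 1).2 (exp_summable c hc0 hc x hx)) ?_ ?_
  · intro k
    exact ((tendsto_pow_atTop_nhds_zero_of_norm_lt_one hq).pow k).const_mul _
  · refine Eventually.of_forall fun n k => ?_
    rw [norm_mul]
    refine mul_le_of_le_one_right (norm_nonneg _) ?_
    rw [norm_pow, norm_pow]
    exact pow_le_one₀ (by positivity) (pow_le_one₀ (by positivity) hq.le)

end expo

end PExpAux

namespace PExpAux

/-- The group of units congruent to one. -/
def oneUnits (K : Type*) [NormedField K] (hna : ∀ x y : K, ‖x + y‖ ≤ max ‖x‖ ‖y‖) :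
    Subgroup Kˣ where
  carrier := {u | ‖(u : K) - 1‖ < 1}
  one_mem' := by simp
  mul_mem' := by
    intro a b ha hb
    simp only [Set.mem_ofPred_eq, Units.val_mul] at *
    have ha1 : ‖(a : K)‖ ≤ 1 := by
      have := hna ((a : K) - 1) 1
      rw [sub_add_cancel, norm_one] at this
      exact this.trans (max_le ha.le le_rfl)
    have h : (a : K) * b - 1 = a * (b - 1) + (a - 1) := by ring
    rw [h]
    refine (hna _ _).trans_lt (max_lt ?_ ha)
    rw [norm_mul]
    exact (mul_le_of_le_one_left (norm_nonneg _) ha1).trans_lt hb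
  inv_mem' := by
    intro a ha
    simp only [Set.mem_ofPred_eq] at *
    have ha1 : 1 ≤ ‖(a : K)‖ := by
      by_contra! h
      have := hna (a : K) (1 - a)
      rw [add_sub_cancel, norm_one, norm_sub_rev] at this
      exact absurd this (not_le.2 (max_lt h ha))
    have h : ((a⁻¹ : Kˣ) : K) - 1 = -((a : K)⁻¹ * (a - 1)) := by
      have : (a : K) ≠ 0 := a.ne_zero
      rw [Units.val_inv_eq_inv_val]
      field_simp
      ring
    rw [h, norm_neg, norm_mul, norm_inv]
    exact (mul_le_of_le_one_left (norm_nonneg _) (inv_le_one_of_one_le₀ ha1)).trans_lt ha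

lemma exists_root {K : Type*} [NormedField K] [IsAlgClosed K] (n : ℕ) (hn : n ≠ 0) (u : K)
    (hu : ‖u - 1‖ < 1) : ∃ v : K, v ^ n = u ∧ ‖v - 1‖ < 1 := by
  classical
  set P : Polynomial K := Polynomial.X ^ n - Polynomial.C u with hP
  have hm : P.Monic := Polynomial.monic_X_pow_sub_C u hn
  have hs := IsAlgClosed.splits P
  have h1 : P = (P.roots.map fun a => Polynomial.X - Polynomial.C a).prod :=
    hs.eq_prod_roots_of_monic hm
  have h2 : 1 - u = (P.roots.map fun a => 1 - a).prod := by
    have h3 := congrArg (Polynomial.eval 1) h1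
    rw [Polynomial.eval_multiset_prod, Multiset.map_map] at h3
    simpa [hP] using h3
  by_contra! hcon
  have h4 : ∀ s : Multiset K, (∀ a ∈ s, 1 ≤ ‖1 - a‖) → 1 ≤ ‖(s.map fun a => 1 - a).prod‖ := by
    intro s
    induction s using Multiset.induction_on with
    | empty => simp
    | cons a s ih =>
      intro h
      rw [Multiset.map_cons, Multiset.prod_cons, norm_mul]
      exact one_le_mul_of_one_le_of_one_le (h a (by simp))
        (ih fun b hb => h b (by simp [hb]))
  have h5 := h4 P.roots fun a ha => by
    rw [norm_sub_rev]
    refine hcon a ?_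
    have := (Polynomial.mem_roots hm.ne_zero).1 ha
    simpa [hP, sub_eq_zero] using this
  rw [← h2, norm_sub_rev] at h5
  linarith

lemma baer_oneUnits (K : Type*) [NormedField K] [IsAlgClosed K]
    (hna : ∀ x y : K, ‖x + y‖ ≤ max ‖x‖ ‖y‖) :
    Module.Baer ℤ (Additive (oneUnits K hna)) := by
  have hnat : ∀ n : ℕ, n ≠ 0 → ∀ a : oneUnits K hna, ∃ b : oneUnits K hna, b ^ n = a := by
    intro n hn a
    obtain ⟨v, hv, hv1⟩ := exists_root n hn ((a : Kˣ) : K) a.2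
    have hv0 : v ≠ 0 := by
      rintro rfl
      simp at hv1
    exact ⟨⟨Units.mk0 v hv0, hv1⟩, Subtype.ext (Units.ext (by simpa using hv))⟩
  letI : DivisibleBy (Additive (oneUnits K hna)) ℤ := divisibleByOfSMulRightSurj _ _ (by
    intro n hn a
    obtain ⟨b, hb⟩ := hnat n.natAbs (by omega) a.toMul
    rcases Int.natAbs_eq n with h | h
    · refine ⟨Additive.ofMul b, ?_⟩
      show n • Additive.ofMul b = a
      rw [h, natCast_zsmul, ← ofMul_pow, hb]; rfl
    · refine ⟨-Additive.ofMul b, ?_⟩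
      show n • (-Additive.ofMul b) = a
      rw [h, neg_smul, smul_neg, neg_neg, natCast_zsmul, ← ofMul_pow, hb]; rfl)
  exact Module.Baer.of_divisible _

/-- The ball of convergence. -/
def convBall (K : Type*) [NormedField K] (hna : ∀ x y : K, ‖x + y‖ ≤ max ‖x‖ ‖y‖)
    (c : ℝ) (hc0 : 0 ≤ c) : AddSubgroup K where
  carrier := {x | ‖x‖ * c < 1}
  zero_mem' := by simp
  add_mem' := by
    intro a b ha hb
    simp only [Set.mem_ofPred_eq] at *
    refine (mul_le_mul_of_nonneg_right (hna a b) hc0).trans_lt ?_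
    rw [max_mul_of_nonneg _ _ hc0]
    exact max_lt ha hb
  neg_mem' := by
    intro a ha
    simpa using ha

lemma norm_nat (p : ℕ) [Fact p.Prime] (K : Type*) [NormedField K] [Algebra ℚ_[p] K]
    (hiso : ∀ a : ℚ_[p], ‖algebraMap ℚ_[p] K a‖ = ‖a‖) (n : ℕ) (hn : n ≠ 0) :
    ‖(n : K)‖ = ((p : ℝ) ^ (padicValNat p n))⁻¹ := by
  have h := hiso (n : ℚ_[p])
  rw [map_natCast] at h
  rw [h, Padic.norm_eq_zpow_neg_valuation (by exact_mod_cast hn), Padic.valuation_natCast,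
    zpow_neg, zpow_natCast]

lemma ball_cond (p : ℕ) [hp : Fact p.Prime] (r : ℝ) (hr : r < (p : ℝ) ^ (-(padicAlpha p))) :
    r * (p : ℝ) ^ (1 / ((p : ℝ) - 1)) < 1 := by
  have hp1 : (1 : ℝ) < p := by exact_mod_cast hp.out.one_lt
  have hα : 1 / ((p : ℝ) - 1) ≤ padicAlpha p := by
    unfold padicAlpha
    split_ifs with h
    · subst h; norm_num
    · exact le_rfl
  have hpos : (0 : ℝ) < (p : ℝ) ^ (1 / ((p : ℝ) - 1)) := Real.rpow_pos_of_pos (by linarith) _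
  calc _ < (p : ℝ) ^ (-(padicAlpha p)) * (p : ℝ) ^ (1 / ((p : ℝ) - 1)) := by gcongr
    _ ≤ (p : ℝ) ^ (-(1 / ((p : ℝ) - 1))) * (p : ℝ) ^ (1 / ((p : ℝ) - 1)) := by
        gcongr; exact hp1.le
    _ = 1 := by rw [← Real.rpow_add (by linarith)]; simp

end PExpAux

/-- Let `K` be an algebraically closed complete nonarchimedean normed
field with an isometric `ℚ_p`-algebra structure and `α` as above. Then an exponential for
`K` exists: a group homomorphism `Exp : (K, +) → (1 + 𝔪_K, ×)` splitting the `p`-adic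
logarithm and restricting to the `p`-adic exponential series on the ball `‖x‖ < p^{-α}`. -/
theorem stmt10 (p : ℕ) [Fact p.Prime] (K : Type*) [NormedField K] [CompleteSpace K]
    [IsAlgClosed K] [Algebra ℚ_[p] K]
    (hna : ∀ x y : K, ‖x + y‖ ≤ max ‖x‖ ‖y‖)
    (hiso : ∀ a : ℚ_[p], ‖algebraMap ℚ_[p] K a‖ = ‖a‖) :
    ∃ Exp : K → K,
      (∀ a : K, ‖Exp a - 1‖ < 1) ∧
      (∀ a b : K, Exp (a + b) = Exp a * Exp b) ∧
      (∀ a : K, pLog (Exp a) = a) ∧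
      (∀ x : K, ‖x‖ < (p : ℝ) ^ (-(padicAlpha p)) → Exp x = pExp x) := by
  classical
  have hn := PExpAux.norm_nat p K hiso
  have := PExpAux.char_zero p hn
  have hp : p.Prime := Fact.out
  have hpK : (p : K) ≠ 0 := by exact_mod_cast hp.ne_zero
  set c : ℝ := (p : ℝ) ^ (1 / ((p : ℝ) - 1)) with hcdef
  have hc0 : 0 ≤ c := by positivity
  have hc := PExpAux.fact_bound p hn
  rw [← hcdef] at hc
  have hnorm := PExpAux.exp_norm c hc0 hc hna
  have hne : ∀ x : K, ‖x‖ * c < 1 → pExp x ≠ 0 := by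
    intro x hx h
    have := hnorm x hx
    rw [h] at this
    simp at this
  -- the exponential on the ball, as an additive homomorphism
  let e : PExpAux.convBall K hna c hc0 →+ Additive (PExpAux.oneUnits K hna) :=
    AddMonoidHom.mk'
      (fun x => Additive.ofMul ⟨Units.mk0 (pExp (x : K)) (hne x x.2), hnorm x x.2⟩) (by
        intro x y
        rw [← ofMul_mul]
        congr 1
        exact Subtype.ext (Units.ext (PExpAux.exp_add' c hc0 hc x y x.2 y.2)))
  obtain ⟨E, hE⟩ := (PExpAux.baer_oneUnits K hna).extension_property_addMonoidHom
    (PExpAux.convBall K hna c hc0).subtype Subtype.val_injective e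
  have hEx : ∀ x : K, ‖x‖ * c < 1 → (((E x).toMul : Kˣ) : K) = pExp x := by
    intro x hx
    have := DFunLike.congr_fun hE ⟨x, hx⟩
    have h2 : E x = e ⟨x, hx⟩ := this
    rw [h2]; rfl
  have hadd : ∀ a b : K, (((E (a + b)).toMul : Kˣ) : K) =
      (((E a).toMul : Kˣ) : K) * (((E b).toMul : Kˣ) : K) := by
    intro a b
    rw [map_add]; rfl
  have hpow : ∀ (n : ℕ) (a : K), (((E ((n : K) * a)).toMul : Kˣ) : K) =
      (((E a).toMul : Kˣ) : K) ^ n := by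
    intro n a
    rw [← nsmul_eq_mul, map_nsmul]; simp
  have hpow' : ∀ (n : ℕ) (a : K), (((E ((p : K) ^ n * a)).toMul : Kˣ) : K) =
      (((E a).toMul : Kˣ) : K) ^ (p ^ n) := by
    intro n a
    rw [← hpow]; push_cast; rfl
  have hunit : ∀ a : K, ‖(((E a).toMul : Kˣ) : K) - 1‖ < 1 := fun a => (E a).toMul.2
  have hlogexp : ∀ x : K, ‖x‖ * c < 1 → pLog (((E x).toMul : Kˣ) : K) = x := by
    intro x hx
    refine tendsto_nhds_unique (PExpAux.log_limit p hn _ (hunit x)) ?_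
    refine (PExpAux.exp_lim c hc0 hc x hx p hpK (PExpAux.p_norm p hn)).congr fun n => ?_
    rw [← hpow', hEx]
    refine lt_of_le_of_lt ?_ hx
    gcongr
    rw [norm_mul, norm_pow]
    exact mul_le_of_le_one_left (norm_nonneg _)
      (pow_le_one₀ (norm_nonneg _) (PExpAux.p_norm p hn).le)
  refine ⟨fun a => (((E a).toMul : Kˣ) : K), hunit, hadd, fun a => ?_, fun x hx => ?_⟩
  · have ht : Tendsto (fun n : ℕ => ‖(p : K) ^ n * a‖ * c) atTop (𝓝 0) := by
      have := (((PExpAux.pow_tendsto p hn).mul_const a).norm).mul_const c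
      simpa using this
    obtain ⟨m, hm⟩ := (ht.eventually (gt_mem_nhds one_pos)).exists
    have h1 := hlogexp _ hm
    rw [hpow', PExpAux.log_pow p hn _ m (hunit a) (by rw [← hpow']; exact hunit _)] at h1
    exact mul_left_cancel₀ (pow_ne_zero m hpK) h1
  · exact hEx x (PExpAux.ball_cond p _ hx)
end
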